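/- For every α ∈ (0, 1/4) there exists h₀ such that the following holds for all integers h ≥ h₀ and all real c ∈ [1, h]. If {B_x : x ∈ V(T)} is a tree-partition of G_h of width less than c·h, then there exists a node x ∈ V(T) and a subset R ⊆ B_x such that (i) R is unrelated (in T_h); (ii) |R| ≥ α²·h/c; and (iii) every vertex in R has height at least α·h. -/

import Mathlib

/-- An `H`-partition of `G`: a partition of the vertices of `G` into parts indexed by
the vertices of `H` such that the two ends of every edge of `G` lie in the same part
or in parts indexed by adjacent vertices of `H`.  A tree-partition (path-partition,
i.e. layering) is an `H`-partition where `H` is a tree (respectively, a path). -/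
def IsHPartition {α β : Type*} (G : SimpleGraph α) (H : SimpleGraph β)
    (B : β → Set α) : Prop :=
  (∀ v : α, ∃! x : β, v ∈ B x) ∧
  (∀ ⦃v w : α⦄, G.Adj v w → ∀ ⦃x y : β⦄, v ∈ B x → w ∈ B y → x = y ∨ H.Adj x y)

/-- Vertices of the complete binary tree of height `h`: a vertex of depth `i`
is a pair `⟨i, j⟩` where `j < 2 ^ i` is its left-to-right index at depth `i`. -/
abbrev BT (h : ℕ) := Σ i : Fin (h + 1), Fin (2 ^ (i : ℕ))

/-- The root of the complete binary tree. -/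
def btRoot (h : ℕ) : BT h := ⟨0, ⟨0, by positivity⟩⟩

/-- `p` is the parent of `v` in the complete binary tree: the children of
`⟨i, j⟩` are `⟨i + 1, 2 * j⟩` (left) and `⟨i + 1, 2 * j + 1⟩` (right). -/
def IsParent {h : ℕ} (p v : BT h) : Prop :=
  (v.1 : ℕ) = (p.1 : ℕ) + 1 ∧ (v.2 : ℕ) / 2 = (p.2 : ℕ)

/-- The complete binary tree `T_h` of height `h` as a simple graph. -/
def btTree (h : ℕ) : SimpleGraph (BT h) :=
  SimpleGraph.fromRel (fun p v => IsParent p v)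

/-- `a` is an ancestor of `v` (this includes `a = v`). -/
def IsAncestor {h : ℕ} (a v : BT h) : Prop :=
  (a.1 : ℕ) ≤ (v.1 : ℕ) ∧ (a.2 : ℕ) = (v.2 : ℕ) / 2 ^ ((v.1 : ℕ) - (a.1 : ℕ))

/-- A set of vertices of `T_h` is unrelated if no element of it is an ancestor of
another element of it. -/
def Unrelated {h : ℕ} (B : Set (BT h)) : Prop :=
  ∀ a ∈ B, ∀ v ∈ B, a ≠ v → ¬IsAncestor a v

/-- `v` is a leaf of `T_h`, i.e. has depth `h`. -/
def IsLeaf {h : ℕ} (v : BT h) : Prop := (v.1 : ℕ) = h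

/-- The graph `G_h`: the complete binary tree `T_h` together with, for each depth
`i ∈ {1, …, h}`, the edges of a path `D_i` through all the vertices of depth `i`
in left-to-right order. -/
def gGraph (h : ℕ) : SimpleGraph (BT h) :=
  SimpleGraph.fromRel (fun a b =>
    IsParent a b ∨ ((a.1 : ℕ) = (b.1 : ℕ) ∧ (a.2 : ℕ) + 1 = (b.2 : ℕ)))



theorem tree_step_unique {ι : Type} {T : SimpleGraph ι} (hT : T.IsTree) {x y y' z : ι}
    (hy : T.Adj x y) (hy' : T.Adj x y') (h : T.dist y z + 1 = T.dist x z)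
    (h' : T.dist y' z + 1 = T.dist x z) : y = y' := by
  obtain ⟨p, hp⟩ := hT.1.exists_walk_length_eq_dist y z
  obtain ⟨p', hp'⟩ := hT.1.exists_walk_length_eq_dist y' z
  have e1 : (SimpleGraph.Walk.cons hy p).IsPath :=
    SimpleGraph.Walk.isPath_of_length_eq_dist _ (by simp [hp, h])
  have e2 : (SimpleGraph.Walk.cons hy' p').IsPath :=
    SimpleGraph.Walk.isPath_of_length_eq_dist _ (by simp [hp', h'])
  have := (hT.2.subsingleton_path x z).elim ⟨_, e1⟩ ⟨_, e2⟩
  have h3 := congrArg (fun q : T.Path x z => q.1.snd) this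
  simpa using h3

theorem exists_col {ι : Type} {T : SimpleGraph ι} (hT : T.IsTree) (x : ι) :
    ∃ col : ι → ι,
      (∀ z z', z ≠ x → z' ≠ x → (z = z' ∨ T.Adj z z') → col z = col z') ∧
      (∀ y, T.Adj x y → col y = y) ∧
      (∀ z, z ≠ x → T.Adj x (col z) ∧ T.dist (col z) z + 1 = T.dist x z) := by
  have ex : ∀ z, z ≠ x → ∃ y, T.Adj x y ∧ T.dist y z + 1 = T.dist x z := by
    intro z hz
    obtain ⟨p, hp⟩ := hT.1.exists_walk_length_eq_dist x z
    cases p with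
    | nil => exact absurd rfl hz
    | @cons _ y _ ha q =>
      refine ⟨y, ha, ?_⟩
      have h1 := SimpleGraph.dist_le q
      have h2 := hT.1.dist_triangle (u := x) (v := y) (w := z)
      rw [SimpleGraph.dist_eq_one_iff_adj.2 ha] at h2
      simp at hp
      omega
  choose! col hcol using ex
  have key : ∀ z z', z ≠ x → z' ≠ x → T.Adj z z' → T.dist x z < T.dist x z' →
      col z = col z' := by
    intro z z' hz hz' ha hlt
    have h1 := hcol z hz
    have h2 := hcol z' hz'
    have t1 := hT.1.dist_triangle (u := x) (v := col z) (w := z')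
    have t2 := hT.1.dist_triangle (u := col z) (v := z) (w := z')
    rw [SimpleGraph.dist_eq_one_iff_adj.2 ha] at t2
    rw [SimpleGraph.dist_eq_one_iff_adj.2 h1.1] at t1
    exact tree_step_unique hT h1.1 h2.1 (by omega) h2.2
  refine ⟨col, ?_, ?_, hcol⟩
  · rintro z z' hz hz' (rfl | ha)
    · rfl
    · have := hT.dist_ne_of_adj x ha
      rcases lt_or_gt_of_ne this with h | h
      · exact key z z' hz hz' ha h
      · exact (key z' z hz' hz ha.symm h).symm
  · intro y hy
    have h := hcol y hy.ne'
    rw [SimpleGraph.dist_eq_one_iff_adj.2 hy] at h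
    have : T.dist (col y) y = 0 := by omega
    exact hT.1.dist_eq_zero_iff.1 this

/-- A median of the family `z`. -/
theorem exists_median {ι : Type} {T : SimpleGraph ι} (hT : T.IsTree) (n : ℕ) (z : ℕ → ι) :
    ∃ x : ι, ∀ y, T.Adj x y → ∀ s ⊆ Finset.range n,
      (∀ j ∈ Finset.range n, j ∉ s → T.dist y (z j) + 1 = T.dist x (z j)) → n ≤ 2 * s.card := by
  have := hT.1.nonempty
  let Φ : ι → ℕ := fun x => ∑ j ∈ Finset.range n, T.dist x (z j)
  obtain ⟨x, hx⟩ : ∃ x, ∀ y, Φ x ≤ Φ y := by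
    obtain ⟨x, -, hx⟩ := WellFounded.has_min (measure Φ).wf Set.univ Set.univ_nonempty
    exact ⟨x, fun y => not_lt.1 (hx y trivial)⟩
  refine ⟨x, fun y hy s hs h => ?_⟩
  have h1 := hx y
  have h2 : ∑ j ∈ Finset.range n, (T.dist y (z j) + 1) ≤
      ∑ j ∈ Finset.range n, (T.dist x (z j) + 2 * (if j ∈ s then 1 else 0)) := by
    apply Finset.sum_le_sum
    intro j hj
    split_ifs with hjs
    · have t := hT.1.dist_triangle (u := y) (v := x) (w := z j)
      rw [SimpleGraph.dist_eq_one_iff_adj.2 hy.symm] at t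
      omega
    · have := h j hj hjs
      omega
  rw [Finset.sum_add_distrib, Finset.sum_add_distrib, ← Finset.mul_sum, ← Finset.sum_filter,
    Finset.filter_mem_eq_inter, Finset.inter_eq_right.2 hs] at h2
  simp at h2
  simp only [Φ] at h1
  omega

open Classical in
/-- Indices of level-`d` vertices lying in part `x`. -/
noncomputable def AA {ι : Type} (f : ℕ → ℕ → ι) (x : ι) (d : ℕ) : Finset ℕ :=
  (Finset.range (2 ^ d)).filter (fun j => f d j = x)

open Classical in
/-- Indices of level-`d` vertices that are ancestors of a vertex of part `x` of depth `≤ i`. -/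
noncomputable def SS {ι : Type} (f : ℕ → ℕ → ι) (x : ι) (i d : ℕ) : Finset ℕ :=
  (Finset.range (2 ^ d)).filter
    (fun k => ∃ e, d ≤ e ∧ e ≤ i ∧ ∃ j ∈ AA f x e, j / 2 ^ (e - d) = k)

open Classical in
/-- Indices of level-`(d+1)` vertices outside `SS` with a parent in part `x`. -/
noncomputable def OO {ι : Type} (f : ℕ → ℕ → ι) (x : ι) (i d : ℕ) : Finset ℕ :=
  (Finset.range (2 ^ (d + 1))).filter (fun j => j / 2 ∈ AA f x d ∧ j ∉ SS f x i (d + 1))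

section levels
variable {ι : Type} {f : ℕ → ℕ → ι} {x : ι} {i d j k e : ℕ}

theorem mem_AA : j ∈ AA f x d ↔ j < 2 ^ d ∧ f d j = x := by simp [AA]

theorem mem_OO : j ∈ OO f x i d ↔
    j < 2 ^ (d + 1) ∧ j / 2 ∈ AA f x d ∧ j ∉ SS f x i (d + 1) := by simp [OO]

theorem SS_of_AA (he : e ≤ i) (hd : d ≤ e) (hj : j ∈ AA f x e) :
    j / 2 ^ (e - d) ∈ SS f x i d := by
  have h1 := (mem_AA.1 hj).1
  simp only [SS, Finset.mem_filter, Finset.mem_range]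
  refine ⟨?_, e, hd, he, j, hj, rfl⟩
  apply Nat.div_lt_of_lt_mul
  rw [← pow_add]
  rwa [Nat.sub_add_cancel hd]

theorem SS_of_AA' (he : d ≤ i) (hj : j ∈ AA f x d) : j ∈ SS f x i d := by
  simpa using SS_of_AA he le_rfl hj

theorem SS_parent (hj : j ∈ SS f x i (d + 1)) : j / 2 ∈ SS f x i d := by
  simp only [SS, Finset.mem_filter] at hj
  obtain ⟨-, e, h1, h2, k, hk, rfl⟩ := hj
  have := SS_of_AA (d := d) h2 (by omega) hk
  have e1 : e - d = (e - (d + 1)) + 1 := by omega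
  rw [e1, pow_succ, ← Nat.div_div_eq_div_mul] at this
  exact this

theorem SS_child (hj : j ∈ SS f x i d) (hA : j ∉ AA f x d) :
    ∃ k ∈ SS f x i (d + 1), k / 2 = j := by
  simp only [SS, Finset.mem_filter] at hj
  obtain ⟨-, e, h1, h2, k, hk, rfl⟩ := hj
  have hne : d ≠ e := by
    rintro rfl
    simp at hA
    exact hA hk
  refine ⟨k / 2 ^ (e - (d + 1)), SS_of_AA h2 (by omega) hk, ?_⟩
  have e1 : e - d = (e - (d + 1)) + 1 := by omega
  rw [e1, pow_succ, ← Nat.div_div_eq_div_mul]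

theorem SS_last : SS f x i i ⊆ AA f x i := by
  intro j hj
  simp only [SS, Finset.mem_filter] at hj
  obtain ⟨-, e, h1, h2, k, hk, rfl⟩ := hj
  obtain rfl : i = e := by omega
  simpa using hk

theorem count_step (hd : d < i) : (SS f x i d).card + (AA f x d).card ≤
    (OO f x i d).card + (SS f x i (d + 1)).card := by
  classical
  have hsub : AA f x d ⊆ SS f x i d := fun j hj => SS_of_AA' hd.le hj
  have hdisj : Disjoint (OO f x i d) (SS f x i (d + 1)) := by
    rw [Finset.disjoint_left]
    intro j hj
    exact (mem_OO.1 hj).2.2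
  rw [← Finset.card_union_of_disjoint hdisj]
  have hmap : ∀ j ∈ OO f x i d ∪ SS f x i (d + 1), j / 2 ∈ SS f x i d := by
    intro j hj
    rcases Finset.mem_union.1 hj with h | h
    · exact hsub (mem_OO.1 h).2.1
    · exact SS_parent h
  rw [Finset.card_eq_sum_card_fiberwise hmap]
  have e1 : (SS f x i d).card + (AA f x d).card =
      ∑ j ∈ SS f x i d, (1 + if j ∈ AA f x d then 1 else 0) := by
    rw [Finset.sum_add_distrib, ← Finset.sum_filter, Finset.filter_mem_eq_inter,
      Finset.inter_eq_right.2 hsub]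
    simp
  rw [e1]
  apply Finset.sum_le_sum
  intro j hj
  split_ifs with hA
  · have hlt := (mem_AA.1 hA).1
    have hin : ∀ k, k / 2 = j → k ∈ OO f x i d ∪ SS f x i (d + 1) := by
      intro k hk
      by_cases hS : k ∈ SS f x i (d + 1)
      · exact Finset.mem_union_right _ hS
      · refine Finset.mem_union_left _ (mem_OO.2 ⟨?_, by rwa [hk], hS⟩)
        rw [pow_succ]; omega
    have : ({2 * j, 2 * j + 1} : Finset ℕ) ⊆
        (OO f x i d ∪ SS f x i (d + 1)).filter (fun k => k / 2 = j) := by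
      intro k hk
      simp only [Finset.mem_insert, Finset.mem_singleton] at hk
      have : k / 2 = j := by omega
      exact Finset.mem_filter.2 ⟨hin k this, this⟩
    have h2 := Finset.card_le_card this
    rw [Finset.card_pair (by omega)] at h2
    exact h2
  · obtain ⟨k, hk, hkj⟩ := SS_child hj hA
    have : 0 < ((OO f x i d ∪ SS f x i (d + 1)).filter (fun k => k / 2 = j)).card :=
      Finset.card_pos.2 ⟨k, Finset.mem_filter.2 ⟨Finset.mem_union_right _ hk, hkj⟩⟩
    omega

theorem count_all (n : ℕ) (hn : n ≤ i) : ∑ d ∈ Finset.range n, (AA f x d).card ≤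
    ∑ d ∈ Finset.range n, (OO f x i d).card + (SS f x i n).card := by
  induction n with
  | zero => simp
  | succ n ih =>
    have h1 := ih (by omega)
    have h2 := count_step (f := f) (x := x) (i := i) (d := n) (by omega)
    rw [Finset.sum_range_succ, Finset.sum_range_succ]
    omega

theorem count_total : ∑ d ∈ Finset.range i, (AA f x d).card ≤
    ∑ d ∈ Finset.range i, (OO f x i d).card + (AA f x i).card :=
  (count_all i le_rfl).trans (by
    have := Finset.card_le_card (SS_last (f := f) (x := x) (i := i))
    omega)

end levels

/-- The level structure of a tree-partition of `G_h`. -/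
structure Lev {ι : Type} (T : SimpleGraph ι) (h : ℕ) (f : ℕ → ℕ → ι) : Prop where
  par : ∀ d j, d < h → j < 2 ^ (d + 1) → f d (j / 2) = f (d + 1) j ∨ T.Adj (f d (j / 2)) (f (d + 1) j)
  hor : ∀ d j, d ≤ h → j + 1 < 2 ^ d → f d j = f d (j + 1) ∨ T.Adj (f d j) (f d (j + 1))

section color
variable {ι : Type} {T : SimpleGraph ι} {h : ℕ} {f : ℕ → ℕ → ι} {x : ι} {col : ι → ι}

theorem level_hit (L : Lev T h f)
    (hcol : ∀ z z', z ≠ x → z' ≠ x → (z = z' ∨ T.Adj z z') → col z = col z')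
    (hside : ∀ z, z ≠ x → T.Adj x (col z) ∧ T.dist (col z) z + 1 = T.dist x z)
    (hmed : ∀ y, T.Adj x y → ∀ s ⊆ Finset.range (2 ^ h),
      (∀ j ∈ Finset.range (2 ^ h), j ∉ s → T.dist y (f h j) + 1 = T.dist x (f h j)) →
        2 ^ h ≤ 2 * s.card)
    {d : ℕ} (hd : d ≤ h)
    (hN : 2 * ∑ e ∈ Finset.range (h + 1), (AA f x e).card < 2 ^ d) : (AA f x d).Nonempty := by
  classical
  by_contra hne
  rw [Finset.not_nonempty_iff_eq_empty] at hne
  have hx : ∀ j, j < 2 ^ d → f d j ≠ x := by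
    intro j hj hjx
    have : j ∈ AA f x d := mem_AA.2 ⟨hj, hjx⟩
    simp [hne] at this
  set y := col (f d 0) with hy
  have h0 : f d 0 ≠ x := hx 0 (by positivity)
  have hall : ∀ j, j < 2 ^ d → col (f d j) = y := by
    intro j
    induction j with
    | zero => intro _; rfl
    | succ j ih =>
      intro hj
      rw [← ih (by omega)]
      exact (hcol _ _ (hx j (by omega)) (hx (j + 1) hj) (L.hor d j hd hj)).symm
  let bad : ℕ → Finset ℕ := fun e =>
    (Finset.range (2 ^ e)).filter (fun j => ¬ (f e j ≠ x ∧ col (f e j) = y))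
  have hb0 : (bad d).card = 0 := by
    rw [Finset.card_eq_zero, Finset.filter_eq_empty_iff]
    intro j hj
    rw [Finset.mem_range] at hj
    exact not_not.2 ⟨hx j hj, hall j hj⟩
  have hstep : ∀ e, e < h → (bad (e + 1)).card ≤ 2 * (bad e).card + (AA f x (e + 1)).card := by
    intro e he
    have hsub : bad (e + 1) ⊆ ((bad e).image (fun j => 2 * j) ∪ (bad e).image (fun j => 2 * j + 1))
        ∪ AA f x (e + 1) := by
      intro j hj
      obtain ⟨hj1, hj2⟩ := Finset.mem_filter.1 hj
      rw [Finset.mem_range] at hj1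
      by_cases hjx : f (e + 1) j = x
      · exact Finset.mem_union_right _ (mem_AA.2 ⟨hj1, hjx⟩)
      · apply Finset.mem_union_left
        have hb : j / 2 ∈ bad e := by
          refine Finset.mem_filter.2 ⟨Finset.mem_range.2 (by rw [pow_succ] at hj1; omega), ?_⟩
          rintro ⟨h1, h2⟩
          exact hj2 ⟨hjx, by rw [← h2]; exact (hcol _ _ h1 hjx (L.par e j he hj1)).symm⟩
        rcases Nat.even_or_odd' j with ⟨m, hm | hm⟩
        · exact Finset.mem_union_left _ (Finset.mem_image.2 ⟨j / 2, hb, by omega⟩)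
        · exact Finset.mem_union_right _ (Finset.mem_image.2 ⟨j / 2, hb, by omega⟩)
    have c1 := Finset.card_le_card hsub
    have c2 := Finset.card_union_le ((bad e).image (fun j => 2 * j) ∪
      (bad e).image (fun j => 2 * j + 1)) (AA f x (e + 1))
    have c3 := Finset.card_union_le ((bad e).image (fun j => 2 * j))
      ((bad e).image (fun j => 2 * j + 1))
    have c4 := Finset.card_image_le (s := bad e) (f := fun j => 2 * j)
    have c5 := Finset.card_image_le (s := bad e) (f := fun j => 2 * j + 1)
    omega
  have hind : ∀ t, d + t ≤ h → (bad (d + t)).card ≤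
      2 ^ t * ∑ e ∈ Finset.range (d + t + 1), (AA f x e).card := by
    intro t
    induction t with
    | zero => intro _; simp [hb0]
    | succ t ih =>
      intro ht
      have i1 := ih (by omega)
      have i2 := hstep (d + t) (by omega)
      rw [← add_assoc, Finset.sum_range_succ, pow_succ]
      have : 1 ≤ 2 ^ t := Nat.one_le_two_pow
      nlinarith [Nat.zero_le (AA f x (d + t + 1)).card]
  have hfin := hind (h - d) (by omega)
  rw [Nat.add_sub_cancel' hd] at hfin
  have hm := hmed y (hside _ h0).1 (bad h) (Finset.filter_subset _ _) (by
    intro j hj hjb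
    have : f h j ≠ x ∧ col (f h j) = y := by
      by_contra hc
      exact hjb (Finset.mem_filter.2 ⟨hj, hc⟩)
    rw [← this.2]
    exact (hside _ this.1).2)
  have hp : 2 ^ h = 2 ^ (h - d) * 2 ^ d := by rw [← pow_add, Nat.sub_add_cancel hd]
  have hpos : 0 < 2 ^ (h - d) := by positivity
  nlinarith

theorem colours (L : Lev T h f)
    (hcol : ∀ z z', z ≠ x → z' ≠ x → (z = z' ∨ T.Adj z z') → col z = col z')
    {d : ℕ} (hd : d ≤ h) :
    ∃ C : Finset ι, C.card ≤ (AA f x d).card + 1 ∧ ∀ j, j < 2 ^ d → f d j ≠ x →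
      col (f d j) ∈ C := by
  classical
  refine ⟨insert (col (f d (2 ^ d - 1))) ((AA f x d).image (fun u => col (f d (u - 1)))), ?_, ?_⟩
  · have c1 := Finset.card_insert_le (col (f d (2 ^ d - 1)))
      ((AA f x d).image (fun u => col (f d (u - 1))))
    have c2 := Finset.card_image_le (s := AA f x d) (f := fun u => col (f d (u - 1)))
    omega
  · have key : ∀ n j, j + n + 1 = 2 ^ d → f d j ≠ x → col (f d j) ∈
        insert (col (f d (2 ^ d - 1))) ((AA f x d).image (fun u => col (f d (u - 1)))) := by
      intro n
      induction n with
      | zero =>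
        intro j hj _
        have : j = 2 ^ d - 1 := by omega
        rw [← this]
        exact Finset.mem_insert_self _ _
      | succ n ih =>
        intro j hj hjx
        by_cases hx : f d (j + 1) = x
        · apply Finset.mem_insert_of_mem
          exact Finset.mem_image.2 ⟨j + 1, mem_AA.2 ⟨by omega, hx⟩, by simp⟩
        · rw [hcol _ _ hjx hx (L.hor d j hd (by omega))]
          exact ih (j + 1) (by omega) hx
    intro j hj hjx
    exact key (2 ^ d - 1 - j) j (by omega) hjx

theorem not_SS_desc (L : Lev T h f)
    (hcol : ∀ z z', z ≠ x → z' ≠ x → (z = z' ∨ T.Adj z z') → col z = col z')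
    {i : ℕ} (hi : i ≤ h) {C : Finset ι}
    (hC : ∀ j, j < 2 ^ i → f i j ≠ x → col (f i j) ∈ C) :
    ∀ t d j, d + t = i → j < 2 ^ d → j ∉ SS f x i d → f d j ≠ x ∧ col (f d j) ∈ C := by
  intro t
  induction t with
  | zero =>
    intro d j hdt hj hS
    obtain rfl : d = i := by omega
    have hx : f d j ≠ x := fun hx => hS (SS_of_AA' le_rfl (mem_AA.2 ⟨hj, hx⟩))
    exact ⟨hx, hC j hj hx⟩
  | succ t ih =>
    intro d j hdt hj hS
    have hx : f d j ≠ x := fun hx => hS (SS_of_AA' (by omega) (mem_AA.2 ⟨hj, hx⟩))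
    have hlt : 2 * j < 2 ^ (d + 1) := by rw [pow_succ]; omega
    have hS' : 2 * j ∉ SS f x i (d + 1) := fun hc => hS (by
      have := SS_parent hc
      rwa [show 2 * j / 2 = j by omega] at this)
    obtain ⟨h1, h2⟩ := ih (d + 1) (2 * j) (by omega) hlt hS'
    refine ⟨hx, ?_⟩
    have hp := L.par d (2 * j) (by omega) hlt
    rw [show 2 * j / 2 = j by omega] at hp
    rw [hcol _ _ hx h1 hp]
    exact h2

end color

theorem pow_bound (m : ℕ) (hm : 19 ≤ m) : 2 * (16 * m + 16) ^ 2 ≤ 2 ^ m := by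
  induction m, hm using Nat.le_induction with
  | base => norm_num
  | succ n hn ih =>
    rw [pow_succ 2 n]
    nlinarith

theorem core {ι : Type} {T : SimpleGraph ι} (hT : T.IsTree) {h : ℕ} {f : ℕ → ℕ → ι}
    (L : Lev T h f) (hh : 320 ≤ h) (c : ℝ) (hc1 : 1 ≤ c) (hch : c ≤ h)
    (hw : ∀ x, ((∑ e ∈ Finset.range (h + 1), (AA f x e).card : ℕ) : ℝ) < c * h) :
    ∃ y, ∃ F : Finset (ℕ × ℕ),
      (∀ p ∈ F, 4 * p.1 ≤ 3 * h ∧ p.2 < 2 ^ p.1 ∧ f p.1 p.2 = y) ∧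
      (∀ p ∈ F, ∀ q ∈ F, p.1 < q.1 → p.2 ≠ q.2 / 2 ^ (q.1 - p.1)) ∧
      (h : ℝ) / (16 * c) ≤ F.card := by
  classical
  obtain ⟨x, hmed⟩ := exists_median hT (2 ^ h) (f h)
  obtain ⟨col, hcol, hadj, hside⟩ := exists_col hT x
  have hwx := hw x
  set N := ∑ e ∈ Finset.range (h + 1), (AA f x e).card with hNdef
  have hhR : (320 : ℝ) ≤ h := by exact_mod_cast hh
  have hN2 : N < h ^ 2 := by
    have : (N : ℝ) < (h : ℝ) ^ 2 := by nlinarith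
    exact_mod_cast this
  have hpow : 2 * h ^ 2 ≤ 2 ^ (h / 16) := by
    have h1 := pow_bound (h / 16) (by omega)
    have h2 : h ≤ 16 * (h / 16) + 16 := by omega
    have h3 := Nat.pow_le_pow_left h2 2
    omega
  have hhit : ∀ d, h / 16 ≤ d → d ≤ h → 1 ≤ (AA f x d).card := by
    intro d hd1 hd2
    apply Finset.card_pos.2
    apply level_hit L hcol hside hmed hd2
    have := Nat.pow_le_pow_right (n := 2) (by norm_num) hd1
    omega
  -- choose the level `i`
  obtain ⟨i, hiJ, himin⟩ := Finset.exists_min_image (Finset.Icc (h / 2 + 1) (3 * h / 4))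
    (fun e => (AA f x e).card) ⟨h / 2 + 1, Finset.mem_Icc.2 ⟨le_rfl, by omega⟩⟩
  rw [Finset.mem_Icc] at hiJ
  set a := (AA f x i).card with ha
  have haN : (3 * h / 4 - h / 2) * a ≤ N := by
    have h1 := Finset.card_nsmul_le_sum _ _ a himin
    have h2 : ∑ e ∈ Finset.Icc (h / 2 + 1) (3 * h / 4), (AA f x e).card ≤ N := by
      apply Finset.sum_le_sum_of_subset
      intro e he
      rw [Finset.mem_Icc] at he
      rw [Finset.mem_range]
      omega
    rw [Nat.card_Icc, smul_eq_mul] at h1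
    rw [show 3 * h / 4 - h / 2 = 3 * h / 4 + 1 - (h / 2 + 1) by omega]
    exact h1.trans h2
  have ha5 : (a : ℝ) < 5 * c := by
    have h1 : h - 3 ≤ 4 * (3 * h / 4 - h / 2) := by omega
    have h2 : (h - 3) * a ≤ 4 * N := by nlinarith
    have h3 : h * a ≤ 4 * N + 3 * a := by
      have h5 : (h - 3) * a + 3 * a = h * a := by
        rw [← Nat.add_mul, Nat.sub_add_cancel (by omega)]
      linarith
    have h4 : (h : ℝ) * a ≤ 4 * N + 3 * a := by exact_mod_cast h3
    by_contra hcon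
    push Not at hcon
    nlinarith
  set K : ℝ := (h : ℝ) / (16 * c) with hK
  have hKc : K * (16 * c) = h := by
    rw [hK]; field_simp
  have hK16 : K ≤ h / 16 := by
    have : 0 ≤ K := by positivity
    nlinarith
  by_cases haK : K ≤ a
  · refine ⟨x, (AA f x i).image (fun j => (i, j)), ?_, ?_, ?_⟩
    · intro p hp
      obtain ⟨j, hj, rfl⟩ := Finset.mem_image.1 hp
      exact ⟨by simp only; omega, (mem_AA.1 hj).1, (mem_AA.1 hj).2⟩
    · intro p hp q hq hpq
      obtain ⟨j, hj, rfl⟩ := Finset.mem_image.1 hp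
      obtain ⟨j', hj', rfl⟩ := Finset.mem_image.1 hq
      exact absurd hpq (lt_irrefl _)
    · rw [Finset.card_image_of_injective _ (fun a b hab => (Prod.mk.inj hab).2)]
      exact haK
  push Not at haK
  obtain ⟨C, hCc, hC⟩ := colours L hcol (d := i) (by omega)
  have hdesc := not_SS_desc L hcol (i := i) (by omega) hC
  have hO : ∀ d j, d < i → j ∈ OO f x i d → f (d + 1) j ∈ C := by
    intro d j hd hj
    obtain ⟨h1, h2, h3⟩ := mem_OO.1 hj
    obtain ⟨h4, h5⟩ := hdesc (i - (d + 1)) (d + 1) j (by omega) h1 h3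
    have hp := L.par d j (by omega) h1
    rw [(mem_AA.1 h2).2] at hp
    rcases hp with hp | hp
    · exact absurd hp.symm h4
    · rwa [hadj _ hp] at h5
  let P : Finset (Σ _ : ℕ, ℕ) := (Finset.range i).sigma (fun d => OO f x i d)
  have hPC : ∀ p ∈ P, f (p.1 + 1) p.2 ∈ C := by
    intro p hp
    obtain ⟨h1, h2⟩ := Finset.mem_sigma.1 hp
    exact hO _ _ (Finset.mem_range.1 h1) h2
  have hPcard : P.card = ∑ d ∈ Finset.range i, (OO f x i d).card := Finset.card_sigma _ _
  have hlow : i - h / 16 ≤ P.card + a := by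
    rw [hPcard]
    refine le_trans ?_ count_total
    have : ∑ d ∈ Finset.Ico (h / 16) i, 1 ≤ ∑ d ∈ Finset.range i, (AA f x d).card := by
      refine le_trans (Finset.sum_le_sum (g := fun d => (AA f x d).card) ?_)
        (Finset.sum_le_sum_of_subset ?_)
      · intro d hd
        rw [Finset.mem_Ico] at hd
        exact hhit d hd.1 (by omega)
      · intro d hd
        rw [Finset.mem_Ico] at hd
        exact Finset.mem_range.2 hd.2
    simpa using this
  obtain ⟨y, hyC, hy⟩ : ∃ y ∈ C, K ≤ (P.filter (fun p => f (p.1 + 1) p.2 = y)).card := by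
    by_contra hcon
    push Not at hcon
    have h1 := Finset.card_eq_sum_card_fiberwise hPC
    have h2 : (P.card : ℝ) ≤ C.card * K := by
      rw [h1]
      push_cast
      rw [← nsmul_eq_mul]
      exact Finset.sum_le_card_nsmul _ _ _ (fun y hy => (hcon y hy).le)
    have h3 : (C.card : ℝ) ≤ a + 1 := by exact_mod_cast hCc
    have h4 : h ≤ 2 * i := by omega
    have h5 : 16 * i ≤ 16 * (P.card + a) + h := by omega
    have h4' : (h : ℝ) ≤ 2 * i := by exact_mod_cast h4
    have h5' : 16 * (i : ℝ) ≤ 16 * (P.card + a) + h := by exact_mod_cast h5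
    have hKpos : 0 < K := by
      rw [hK]; positivity
    have h6 : (C.card : ℝ) * K < 6 * c * K := by
      apply mul_lt_mul_of_pos_right _ hKpos
      linarith
    nlinarith
  refine ⟨y, (P.filter (fun p => f (p.1 + 1) p.2 = y)).image (fun p => (p.1 + 1, p.2)), ?_, ?_, ?_⟩
  · intro p hp
    obtain ⟨⟨d, j⟩, hj, rfl⟩ := Finset.mem_image.1 hp
    obtain ⟨h1, h2⟩ := Finset.mem_filter.1 hj
    obtain ⟨h3, h4⟩ := Finset.mem_sigma.1 h1
    rw [Finset.mem_range] at h3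
    simp only at h2 h3 h4 ⊢
    exact ⟨by omega, (mem_OO.1 h4).1, h2⟩
  · intro p hp q hq hpq
    obtain ⟨⟨d, j⟩, hj, rfl⟩ := Finset.mem_image.1 hp
    obtain ⟨⟨d', j'⟩, hj', rfl⟩ := Finset.mem_image.1 hq
    obtain ⟨h3, h4⟩ := Finset.mem_sigma.1 (Finset.mem_filter.1 hj).1
    obtain ⟨h3', h4'⟩ := Finset.mem_sigma.1 (Finset.mem_filter.1 hj').1
    rw [Finset.mem_range] at h3 h3'
    simp only at h3 h4 h3' h4' hpq ⊢
    intro heq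
    apply (mem_OO.1 h4).2.2
    have := SS_of_AA (d := d + 1) (i := i) (by omega) (by omega) (mem_OO.1 h4').2.1
    rw [heq, show d' + 1 - (d + 1) = (d' - (d + 1)) + 1 by omega, pow_succ', 
      ← Nat.div_div_eq_div_mul]
    exact this
  · rw [Finset.card_image_of_injective]
    · exact hy
    · rintro ⟨d, j⟩ ⟨d', j'⟩ hab
      simp only [Prod.mk.injEq, add_left_inj] at hab
      obtain ⟨rfl, rfl⟩ := hab
      rfl

/-- Coordinates of a vertex. -/
def btVal {h : ℕ} (v : BT h) : ℕ × ℕ := (v.1, v.2)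

theorem btVal_inj {h : ℕ} : Function.Injective (btVal (h := h)) := by
  rintro ⟨⟨d, hd⟩, ⟨j, hj⟩⟩ ⟨⟨d', hd'⟩, ⟨j', hj'⟩⟩ hab
  simp only [btVal, Prod.mk.injEq] at hab
  obtain ⟨rfl, rfl⟩ := hab
  rfl

theorem btVal_surj {h : ℕ} (d j : ℕ) (hd : d ≤ h) (hj : j < 2 ^ d) :
    ∃ v : BT h, btVal v = (d, j) := ⟨⟨⟨d, by omega⟩, ⟨j, hj⟩⟩, rfl⟩

/-- For every `α ∈ (0, 1/4)` there is `h₀` such that for all `h ≥ h₀` and `c ∈ [1, h]`: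
every tree-partition of `G_h` of width less than `c * h` has a part containing an
unrelated set `R` of size at least `α² h / c` all of whose vertices have height at
least `α h`. -/
theorem stmt11 (α : ℝ) (hα0 : 0 < α) (hα : α < 1 / 4) :
    ∃ h₀ : ℕ, ∀ h : ℕ, h₀ ≤ h → ∀ c : ℝ, 1 ≤ c → c ≤ h →
      ∀ (ι : Type) (T : SimpleGraph ι) (B : ι → Set (BT h)),
        T.IsTree → IsHPartition (gGraph h) T B →
        (∀ x : ι, ((B x).ncard : ℝ) < c * h) →
        ∃ (x : ι) (R : Set (BT h)), R ⊆ B x ∧ Unrelated R ∧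
          α ^ 2 * h / c ≤ (R.ncard : ℝ) ∧
          ∀ v ∈ R, α * h ≤ (h : ℝ) - ((v.1 : ℕ) : ℝ) := by
  classical
  refine ⟨320, fun h hh c hc1 hch ι T B hT hB hw => ?_⟩
  choose p hp hpu using hB.1
  have hpB : ∀ v x, v ∈ B x ↔ p v = x :=
    fun v x => ⟨fun hv => (hpu v x hv).symm, fun hv => hv ▸ hp v⟩
  have hedge : ∀ v w, (gGraph h).Adj v w → p v = p w ∨ T.Adj (p v) (p w) :=
    fun v w hvw => hB.2 hvw (hp v) (hp w)
  let f : ℕ → ℕ → ι := fun d j =>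
    if hdj : ∃ v : BT h, btVal v = (d, j) then p hdj.choose else p (btRoot h)
  have hf : ∀ v : BT h, f v.1 v.2 = p v := by
    intro v
    have hex : ∃ w : BT h, btVal w = ((v.1 : ℕ), (v.2 : ℕ)) := ⟨v, rfl⟩
    have : hex.choose = v := btVal_inj hex.choose_spec
    simp only [f, dif_pos hex, this]
  have hf' : ∀ (v : BT h) d j, btVal v = (d, j) → f d j = p v := by
    intro v d j hv
    rw [← hf v]
    simp only [btVal, Prod.mk.injEq] at hv
    rw [← hv.1, ← hv.2]
  have L : Lev T h f := by
    constructor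
    · intro d j hd hj
      obtain ⟨v, hv⟩ := btVal_surj (h := h) d (j / 2) (by omega) (by rw [pow_succ] at hj; omega)
      obtain ⟨w, hw⟩ := btVal_surj (h := h) (d + 1) j (by omega) hj
      rw [hf' v _ _ hv, hf' w _ _ hw]
      apply hedge
      simp only [btVal, Prod.mk.injEq] at hv hw
      refine (SimpleGraph.fromRel_adj _ _ _).2 ⟨?_, Or.inl (Or.inl ⟨?_, ?_⟩)⟩
      · rintro rfl
        omega
      · omega
      · rw [hw.2, hv.2]
    · intro d j hd hj
      obtain ⟨v, hv⟩ := btVal_surj (h := h) d j (by omega) (by omega)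
      obtain ⟨w, hw⟩ := btVal_surj (h := h) d (j + 1) (by omega) hj
      rw [hf' v _ _ hv, hf' w _ _ hw]
      apply hedge
      simp only [btVal, Prod.mk.injEq] at hv hw
      refine (SimpleGraph.fromRel_adj _ _ _).2 ⟨?_, Or.inl (Or.inr ⟨?_, ?_⟩)⟩
      · rintro rfl
        omega
      · omega
      · omega
  have hwidth : ∀ x, ((∑ e ∈ Finset.range (h + 1), (AA f x e).card : ℕ) : ℝ) < c * h := by
    intro x
    refine lt_of_le_of_lt ?_ (hw x)
    rw [Nat.cast_le, ← Set.ncard_image_of_injective _ btVal_inj, ← Finset.card_sigma]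
    have hinj : Function.Injective (fun q : (Σ _ : ℕ, ℕ) => (q.1, q.2)) := by
      rintro ⟨d, j⟩ ⟨d', j'⟩ hab
      simp only [Prod.mk.injEq] at hab
      obtain ⟨rfl, rfl⟩ := hab
      rfl
    rw [← Finset.card_image_of_injective _ hinj, ← Set.ncard_coe_finset]
    apply Set.ncard_le_ncard
    · intro q hq
      obtain ⟨⟨d, j⟩, hdj, rfl⟩ := Finset.mem_image.1 (Finset.mem_coe.1 hq)
      obtain ⟨h1, h2⟩ := Finset.mem_sigma.1 hdj
      rw [Finset.mem_range] at h1
      simp only at h1 h2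
      obtain ⟨h3, h4⟩ := mem_AA.1 h2
      obtain ⟨v, hv⟩ := btVal_surj (h := h) d j (by omega) h3
      exact ⟨v, (hpB v x).2 ((hf' v _ _ hv).symm.trans h4), hv⟩
    · exact Set.toFinite _
  obtain ⟨y, F, hF1, hF2, hF3⟩ := core hT L hh c hc1 hch hwidth
  refine ⟨y, {v | btVal v ∈ F}, ?_, ?_, ?_, ?_⟩
  · intro v hv
    rw [hpB, ← hf v]
    exact (hF1 _ hv).2.2
  · rintro a ha v hv hav ⟨h1, h2⟩
    rcases h1.lt_or_eq with h1 | h1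
    · exact hF2 _ ha _ hv h1 h2
    · apply hav
      apply btVal_inj
      simp only [btVal, Prod.mk.injEq]
      exact ⟨h1, by simpa [h1] using h2⟩
  · have hcard : Set.ncard {v : BT h | btVal v ∈ F} = F.card := by
      rw [← Set.ncard_image_of_injective _ btVal_inj, ← Set.ncard_coe_finset]
      congr 1
      ext q
      constructor
      · rintro ⟨v, hv, rfl⟩
        exact hv
      · intro hq
        obtain ⟨h1, h2, -⟩ := hF1 q hq
        obtain ⟨v, hv⟩ := btVal_surj (h := h) q.1 q.2 (by omega) h2
        exact ⟨v, by simpa [hv] using hq, hv⟩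
    rw [hcard]
    refine le_trans ?_ hF3
    have hc0 : 0 < c := by linarith
    rw [div_le_div_iff₀ hc0 (by positivity)]
    have : α ^ 2 ≤ 1 / 16 := by nlinarith
    have hh0 : (0 : ℝ) ≤ h * c := by positivity
    nlinarith
  · intro v hv
    have h1 := (hF1 _ hv).1
    have h2 : 4 * ((v.1 : ℕ) : ℝ) ≤ 3 * h := by exact_mod_cast h1
    have hh0 : (0 : ℝ) ≤ h := by positivity
    nlinarith
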